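/- arXiv:1403.7733 — 2 statements merged into one kernel-verified Lean document; each statement's English description precedes it below -/
import Mathlib

section
/- Let Ω be an unbalanced signed graph with a blocking vertex v (Ω \ v is balanced) such that F(Ω) = M(G) for a 2-connected graph G. Then there exists a graph H that is 2-isomorphic to G such that Ω is obtained from H by a pinch. -/
/-- A multigraph on vertex type `V` with edge type `E`: each edge has an
unordered pair of endpoints (possibly equal, giving a loop). -/
structure Multigraph (V E : Type) where
  ends : E → Sym2 V

namespace Multigraph

variable {V E : Type} [Fintype V] [DecidableEq V] [Fintype E] [DecidableEq E]

/-- The vertices incident with some edge of `C`. -/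
def vertsOf (G : Multigraph V E) (C : Finset E) : Finset V :=
  Finset.univ.filter fun v => ∃ e ∈ C, v ∈ G.ends e

/-- Degree of `v` in the subgraph with edge set `C`; loops count twice. -/
def deg (G : Multigraph V E) (C : Finset E) (v : V) : ℕ :=
  ∑ e ∈ C, (if G.ends e = Sym2.diag v then 2 else if v ∈ G.ends e then 1 else 0)

/-- Reachability using only edges in `C`. -/
def ReachE (G : Multigraph V E) (C : Finset E) (u w : V) : Prop :=
  Relation.ReflTransGen (fun a b => ∃ e ∈ C, a ∈ G.ends e ∧ b ∈ G.ends e) u w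

/-- The subgraph with edge set `C` is connected. -/
def ConnectedOn (G : Multigraph V E) (C : Finset E) : Prop :=
  ∀ u ∈ G.vertsOf C, ∀ w ∈ G.vertsOf C, G.ReachE C u w

/-- `C` is the edge set of a cycle of `G`. -/
def IsCycle (G : Multigraph V E) (C : Finset E) : Prop :=
  C.Nonempty ∧ G.ConnectedOn C ∧ ∀ v ∈ G.vertsOf C, G.deg C v = 2

/-- `P` is the edge set of a path of `G` from `u` to `w` (of positive length). -/
def IsPath (G : Multigraph V E) (P : Finset E) (u w : V) : Prop :=
  u ≠ w ∧ G.ConnectedOn P ∧ u ∈ G.vertsOf P ∧ w ∈ G.vertsOf P ∧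
    G.deg P u = 1 ∧ G.deg P w = 1 ∧
    ∀ v ∈ G.vertsOf P, v ≠ u → v ≠ w → G.deg P v = 2

/-- Theta data: three internally disjoint `u`–`w` paths. -/
def ThetaData (G : Multigraph V E) (P₁ P₂ P₃ : Finset E) (u w : V) : Prop :=
  G.IsPath P₁ u w ∧ G.IsPath P₂ u w ∧ G.IsPath P₃ u w ∧
    Disjoint P₁ P₂ ∧ Disjoint P₁ P₃ ∧ Disjoint P₂ P₃ ∧
    G.vertsOf P₁ ∩ G.vertsOf P₂ = {u, w} ∧
    G.vertsOf P₁ ∩ G.vertsOf P₃ = {u, w} ∧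
    G.vertsOf P₂ ∩ G.vertsOf P₃ = {u, w}

/-- `T` is the edge set of a theta subgraph of `G`. -/
def IsTheta (G : Multigraph V E) (T : Finset E) : Prop :=
  ∃ u w P₁ P₂ P₃, G.ThetaData P₁ P₂ P₃ u w ∧ T = P₁ ∪ P₂ ∪ P₃

/-- The theta property: no theta subgraph contains exactly two balanced cycles. -/
def ThetaProperty (G : Multigraph V E) (B : Set (Finset E)) : Prop :=
  ∀ u w P₁ P₂ P₃, G.ThetaData P₁ P₂ P₃ u w →
    ¬ ((P₁ ∪ P₂ ∈ B ∧ P₁ ∪ P₃ ∈ B ∧ P₂ ∪ P₃ ∉ B) ∨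
       (P₁ ∪ P₂ ∈ B ∧ P₁ ∪ P₃ ∉ B ∧ P₂ ∪ P₃ ∈ B) ∨
       (P₁ ∪ P₂ ∉ B ∧ P₁ ∪ P₃ ∈ B ∧ P₂ ∪ P₃ ∈ B))

/-- `(G, B)` is a biased graph. -/
def IsBiased (G : Multigraph V E) (B : Set (Finset E)) : Prop :=
  (∀ C ∈ B, G.IsCycle C) ∧ G.ThetaProperty B

/-- A tight handcuff: two edge-disjoint cycles meeting in exactly one vertex. -/
def TightHandcuff (G : Multigraph V E) (C₁ C₂ : Finset E) : Prop :=
  G.IsCycle C₁ ∧ G.IsCycle C₂ ∧ Disjoint C₁ C₂ ∧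
    (G.vertsOf C₁ ∩ G.vertsOf C₂).card = 1

/-- A loose handcuff: two vertex-disjoint cycles joined by a path meeting them
only in its endpoints. -/
def LooseHandcuff (G : Multigraph V E) (C₁ C₂ P : Finset E) : Prop :=
  G.IsCycle C₁ ∧ G.IsCycle C₂ ∧ Disjoint (G.vertsOf C₁) (G.vertsOf C₂) ∧
    Disjoint P C₁ ∧ Disjoint P C₂ ∧
    ∃ u₁ u₂, G.IsPath P u₁ u₂ ∧ u₁ ∈ G.vertsOf C₁ ∧ u₂ ∈ G.vertsOf C₂ ∧
      G.vertsOf P ∩ G.vertsOf C₁ = {u₁} ∧ G.vertsOf P ∩ G.vertsOf C₂ = {u₂}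

/-- Circuits of the frame matroid of the biased graph `(G, B)`. -/
def FrameCircuit (G : Multigraph V E) (B : Set (Finset E)) (C : Finset E) : Prop :=
  (G.IsCycle C ∧ C ∈ B) ∨
  (∃ C₁ C₂, G.TightHandcuff C₁ C₂ ∧ C₁ ∉ B ∧ C₂ ∉ B ∧ C = C₁ ∪ C₂) ∨
  (∃ C₁ C₂ P, G.LooseHandcuff C₁ C₂ P ∧ C₁ ∉ B ∧ C₂ ∉ B ∧ C = C₁ ∪ C₂ ∪ P) ∨
  (G.IsTheta C ∧ ∀ D ⊆ C, G.IsCycle D → D ∉ B)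

/-- The balanced cycles of a signed graph `(G, σ)`. -/
def balancedCycles (G : Multigraph V E) (σ : E → ℤˣ) : Set (Finset E) :=
  {C | G.IsCycle C ∧ ∏ e ∈ C, σ e = 1}

/-- Circuits of the frame matroid of a signed graph. -/
def SFrameCircuit (G : Multigraph V E) (σ : E → ℤˣ) (C : Finset E) : Prop :=
  G.FrameCircuit (G.balancedCycles σ) C

/-- Circuits of the lift matroid of a signed graph. -/
def LiftCircuit (G : Multigraph V E) (σ : E → ℤˣ) (C : Finset E) : Prop :=
  (G.IsCycle C ∧ ∏ e ∈ C, σ e = 1) ∨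
  (∃ C₁ C₂, G.IsCycle C₁ ∧ G.IsCycle C₂ ∧
    (∏ e ∈ C₁, σ e) = -1 ∧ (∏ e ∈ C₂, σ e) = -1 ∧ Disjoint C₁ C₂ ∧
    (G.vertsOf C₁ ∩ G.vertsOf C₂).card ≤ 1 ∧ C = C₁ ∪ C₂)

/-- The sign of edge `e` after switching at the vertex labelling `δ`. -/
def switchSign (G : Multigraph V E) (σ : E → ℤˣ) (δ : V → ℤˣ) (e : E) : ℤˣ :=
  Sym2.lift ⟨fun a b => δ a * δ b, fun a b => mul_comm _ _⟩ (G.ends e) * σ e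

/-- Reachability avoiding the vertex set `X`. -/
def ReachAvoiding (G : Multigraph V E) (X : Set V) (u w : V) : Prop :=
  Relation.ReflTransGen
    (fun a b => a ∉ X ∧ b ∉ X ∧ ∃ e, a ∈ G.ends e ∧ b ∈ G.ends e) u w

/-- `G` is 2-connected. -/
def TwoConnected (G : Multigraph V E) : Prop :=
  3 ≤ Fintype.card V ∧ (∀ u w, G.ReachAvoiding ∅ u w) ∧
    ∀ v u w, u ≠ v → w ≠ v → G.ReachAvoiding {v} u w

/-- `G` is 3-connected. -/
def ThreeConnected (G : Multigraph V E) : Prop :=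
  4 ≤ Fintype.card V ∧ (∀ u w, G.ReachAvoiding ∅ u w) ∧
    (∀ v u w, u ≠ v → w ≠ v → G.ReachAvoiding {v} u w) ∧
    ∀ v v' u w, u ∉ ({v, v'} : Set V) → w ∉ ({v, v'} : Set V) →
      G.ReachAvoiding {v, v'} u w

/-- `v` is a cut-vertex of `G`. -/
def CutVertex (G : Multigraph V E) (v : V) : Prop :=
  ∃ u w, u ≠ v ∧ w ≠ v ∧ G.ReachAvoiding ∅ u w ∧ ¬ G.ReachAvoiding {v} u w

/-- `B` is (the edge set of) a block of `G`: an equivalence class of the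
relation "lying on a common cycle". -/
def IsBlock (G : Multigraph V E) (B : Finset E) : Prop :=
  ∃ e, (B : Set E) = {f | f = e ∨ ∃ C, G.IsCycle C ∧ e ∈ C ∧ f ∈ C}

/-- An end-block: a block containing at most one cut-vertex. -/
def EndBlock (G : Multigraph V E) (B : Finset E) : Prop :=
  G.IsBlock B ∧ ∀ a ∈ G.vertsOf B, ∀ b ∈ G.vertsOf B,
    G.CutVertex a → G.CutVertex b → a = b

end Multigraph

/-- Independence for a set system of circuits. -/
def MIndep {E : Type} (Circuits : Set (Finset E)) (X : Finset E) : Prop :=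
  ∀ C ∈ Circuits, ¬ C ⊆ X

/-- The matroid with the given circuits is connected. -/
def MConnected {E : Type} (Circuits : Set (Finset E)) : Prop :=
  ∀ e f : E, e ≠ f → ∃ C ∈ Circuits, e ∈ C ∧ f ∈ C

/-- The matroid with the given circuits is binary (representable over GF(2)). -/
def MBinary {E : Type} [Fintype E] [DecidableEq E] (Circuits : Set (Finset E)) : Prop :=
  ∃ (n : ℕ) (φ : E → (Fin n → ZMod 2)), ∀ X : Finset E,
    MIndep Circuits X ↔ LinearIndependent (ZMod 2) (fun e : {x // x ∈ X} => φ e.1)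


variable {V E : Type} [Fintype V] [DecidableEq V] [Fintype E] [DecidableEq E]


set_option linter.unusedSectionVars false

namespace Multigraph

/-- contribution of an edge to the degree -/
def edeg (G : Multigraph V E) (e : E) (u : V) : ℕ :=
  if G.ends e = Sym2.diag u then 2 else if u ∈ G.ends e then 1 else 0

lemma deg_eq (G : Multigraph V E) (C : Finset E) (u : V) :
    G.deg C u = ∑ e ∈ C, G.edeg e u := rfl

lemma edeg_eq (G : Multigraph V E) {e : E} {a b : V} (h : G.ends e = s(a, b)) (u : V) :
    G.edeg e u = (if u = a then 1 else 0) + (if u = b then 1 else 0) := by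
  unfold edeg
  rw [h]
  have hd : (Sym2.mk a b = Sym2.diag u) ↔ (u = a ∧ u = b) := by
    simp only [Sym2.diag, Sym2.eq_iff]
    constructor
    · rintro (⟨h1, h2⟩ | ⟨h1, h2⟩) <;> exact ⟨h1.symm, h2.symm⟩
    · rintro ⟨h1, h2⟩; exact Or.inl ⟨h1.symm, h2.symm⟩
  simp only [hd, Sym2.mem_iff]
  by_cases h1 : u = a <;> by_cases h2 : u = b <;> simp only [h1, h2] <;> simp_all

lemma edeg_pos (G : Multigraph V E) {e : E} {u : V} : 0 < G.edeg e u ↔ u ∈ G.ends e := by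
  obtain ⟨a, b, h⟩ : ∃ a b, G.ends e = s(a, b) := by
    induction G.ends e using Sym2.ind with | _ a b => exact ⟨a, b, rfl⟩
  rw [edeg_eq G h, h]
  by_cases h1 : u = a <;> by_cases h2 : u = b <;> simp [h1, h2]

lemma exists_ends (G : Multigraph V E) (e : E) : ∃ a b, G.ends e = s(a, b) := by
  induction G.ends e using Sym2.ind with | _ a b => exact ⟨a, b, rfl⟩

lemma mem_vertsOf (G : Multigraph V E) (C : Finset E) (u : V) :
    u ∈ G.vertsOf C ↔ ∃ e ∈ C, u ∈ G.ends e := by simp [vertsOf]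

lemma deg_pos (G : Multigraph V E) (C : Finset E) (u : V) :
    0 < G.deg C u ↔ u ∈ G.vertsOf C := by
  rw [deg_eq, mem_vertsOf, Finset.sum_pos_iff]
  simp only [edeg_pos]

lemma deg_zero (G : Multigraph V E) {C : Finset E} {u : V} (h : u ∉ G.vertsOf C) :
    G.deg C u = 0 := by
  rw [← deg_pos] at h; omega

lemma deg_union (G : Multigraph V E) {A B : Finset E} (h : Disjoint A B) (u : V) :
    G.deg (A ∪ B) u = G.deg A u + G.deg B u := by
  simp only [deg_eq]; exact Finset.sum_union h

lemma deg_sdiff (G : Multigraph V E) {A B : Finset E} (h : A ⊆ B) (u : V) :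
    G.deg (B \ A) u + G.deg A u = G.deg B u := by
  simp only [deg_eq]; exact Finset.sum_sdiff h

lemma deg_mono (G : Multigraph V E) {A B : Finset E} (h : A ⊆ B) (u : V) :
    G.deg A u ≤ G.deg B u := by
  have := deg_sdiff G h u; omega

lemma deg_insert (G : Multigraph V E) {A : Finset E} {e : E} (h : e ∉ A) (u : V) :
    G.deg (insert e A) u = G.edeg e u + G.deg A u := by
  simp only [deg_eq]; exact Finset.sum_insert h

lemma deg_erase (G : Multigraph V E) {A : Finset E} {e : E} (h : e ∈ A) (u : V) :
    G.edeg e u + G.deg (A.erase e) u = G.deg A u := by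
  simp only [deg_eq]; exact Finset.add_sum_erase A (fun e => G.edeg e u) h

lemma handshake (G : Multigraph V E) (C : Finset E) : Even (∑ u, G.deg C u) := by
  simp only [deg_eq]
  rw [Finset.sum_comm]
  apply Finset.even_sum
  intro e _
  obtain ⟨a, b, h⟩ := G.exists_ends e
  simp only [edeg_eq G h, Finset.sum_add_distrib]
  simp

/-- all degrees even -/
def EvenSet (G : Multigraph V E) (C : Finset E) : Prop := ∀ u, Even (G.deg C u)

lemma even_of_all_but_one (G : Multigraph V E) (C : Finset E) (v : V)
    (h : ∀ u, u ≠ v → Even (G.deg C u)) : G.EvenSet C := by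
  intro u
  by_cases huv : u = v
  · subst huv
    have h1 := G.handshake C
    rw [← Finset.add_sum_erase _ _ (Finset.mem_univ u)] at h1
    have h2 : Even (∑ x ∈ Finset.univ.erase u, G.deg C x) :=
      Finset.even_sum _ (fun x hx => h x (Finset.ne_of_mem_erase hx))
    exact (Nat.even_add.1 h1).2 h2
  · exact h u huv

lemma EvenSet.sdiff {G : Multigraph V E} {A B : Finset E} (hB : G.EvenSet B) (hA : G.EvenSet A)
    (h : A ⊆ B) : G.EvenSet (B \ A) := by
  intro u
  have h1 := hB u
  rw [← G.deg_sdiff h u] at h1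
  exact (Nat.even_add.1 h1).2 (hA u)

lemma EvenSet.union {G : Multigraph V E} {A B : Finset E} (hA : G.EvenSet A) (hB : G.EvenSet B)
    (h : Disjoint A B) : G.EvenSet (A ∪ B) := by
  intro u
  rw [G.deg_union h u]
  exact (hA u).add (hB u)

lemma IsCycle.even {G : Multigraph V E} {C : Finset E} (h : G.IsCycle C) : G.EvenSet C := by
  intro u
  by_cases hu : u ∈ G.vertsOf C
  · rw [h.2.2 u hu]; decide
  · rw [G.deg_zero hu]; decide

/-- A walk contains an edge set with prescribed boundary. -/
lemma exists_join (G : Multigraph V E) {F : Finset E} {a b : V} (h : G.ReachE F a b) :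
    ∃ A ⊆ F, (∀ u, Even (G.deg A u + (if u = a then 1 else 0) + (if u = b then 1 else 0))) ∧
      (a ≠ b → G.deg A b = 1) := by
  induction h using Relation.ReflTransGen.head_induction_on with
  | refl =>
    refine ⟨∅, Finset.empty_subset _, ?_, fun h => absurd rfl h⟩
    intro u
    by_cases hu : u = b <;> simp [deg_eq, hu]
  | head hac hcb ih =>
    rename_i a c
    obtain ⟨e, heF, hea, hec⟩ := hac
    obtain ⟨A, hAF, hA, hAb⟩ := ih
    by_cases hac : a = c
    · subst hac; exact ⟨A, hAF, hA, hAb⟩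
    have hends : G.ends e = s(a, c) := (Sym2.mem_and_mem_iff hac).1 ⟨hea, hec⟩
    by_cases hcb' : c = b
    · subst hcb'
      refine ⟨{e}, by simpa using heF, ?_, ?_⟩
      · intro u
        simp only [deg_eq, Finset.sum_singleton, edeg_eq G hends]
        split_ifs <;> decide
      · intro _
        simp only [deg_eq, Finset.sum_singleton, edeg_eq G hends]
        simp [Ne.symm hac]
    · by_cases heA : e ∈ A
      · refine ⟨A.erase e, (Finset.erase_subset _ _).trans hAF, ?_, ?_⟩
        · intro u
          have h1 := hA u
          rw [← G.deg_erase heA u, edeg_eq G hends] at h1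
          rw [Nat.even_iff] at h1 ⊢
          omega
        · intro hab
          have h1 := hAb hcb'
          rw [← G.deg_erase heA b, edeg_eq G hends] at h1
          simpa [Ne.symm hab, Ne.symm hcb'] using h1
      · refine ⟨insert e A, Finset.insert_subset heF hAF, ?_, ?_⟩
        · intro u
          have h1 := hA u
          rw [G.deg_insert heA u, edeg_eq G hends]
          rw [Nat.even_iff] at h1 ⊢
          omega
        · intro hab
          have h1 := hAb hcb'
          rw [G.deg_insert heA b, edeg_eq G hends]
          simpa [Ne.symm hab, Ne.symm hcb'] using h1

lemma reach_step (G : Multigraph V E) {F : Finset E} {a x y : V} {e : E} (he : e ∈ F)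
    (hx : x ∈ G.ends e) (hy : y ∈ G.ends e) (h : G.ReachE F a x) : G.ReachE F a y :=
  Relation.ReflTransGen.tail h ⟨e, he, hx, hy⟩

open Classical in
/-- The edges of `F` in the component of `a`. -/
lemma comp_deg (G : Multigraph V E) (F : Finset E) (a : V) :
    ∃ D ⊆ F, (∀ u, G.ReachE F a u → G.deg D u = G.deg F u) ∧
      (∀ u, ¬ G.ReachE F a u → G.deg D u = 0) ∧
      (∀ e ∈ D, ∃ x ∈ G.ends e, G.ReachE F a x) ∧
      (∀ e ∈ F, (∃ x ∈ G.ends e, G.ReachE F a x) → e ∈ D) := by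
  refine ⟨F.filter fun e => ∃ x ∈ G.ends e, G.ReachE F a x, Finset.filter_subset _ _,
    ?_, ?_, ?_, ?_⟩
  · intro u hu
    simp only [deg_eq]
    refine Finset.sum_subset (Finset.filter_subset _ _) ?_
    intro e he hne
    by_contra h0
    have : u ∈ G.ends e := G.edeg_pos.1 (Nat.pos_of_ne_zero h0)
    exact hne (Finset.mem_filter.2 ⟨he, u, this, hu⟩)
  · intro u hu
    apply G.deg_zero
    rw [mem_vertsOf]
    rintro ⟨e, he, hue⟩
    obtain ⟨heF, x, hx, hr⟩ := Finset.mem_filter.1 he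
    exact hu (G.reach_step heF hx hue hr)
  · intro e he
    exact (Finset.mem_filter.1 he).2
  · intro e he h
    exact Finset.mem_filter.2 ⟨he, h⟩

lemma isCycle_iff (G : Multigraph V E) (C : Finset E) :
    G.IsCycle C ↔ C.Nonempty ∧ G.EvenSet C ∧
      ∀ D ⊆ C, D.Nonempty → G.EvenSet D → D = C := by
  constructor
  · intro h
    refine ⟨h.1, h.even, ?_⟩
    intro D hDC hD hDe
    -- every edge of `C` at a vertex of `D` is in `D`
    have key : ∀ x ∈ G.vertsOf D, ∀ e ∈ C, x ∈ G.ends e → e ∈ D := by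
      intro x hx e he hxe
      have hxC : x ∈ G.vertsOf C := (G.mem_vertsOf C x).2 ⟨e, he, hxe⟩
      have h2 := h.2.2 x hxC
      have h3 := (G.deg_pos D x).2 hx
      have h4 := hDe x
      have h5 := G.deg_sdiff hDC x
      have h6 : G.deg (C \ D) x = 0 := by
        rw [Nat.even_iff] at h4; omega
      by_contra hne
      have : x ∈ G.vertsOf (C \ D) :=
        (G.mem_vertsOf _ x).2 ⟨e, Finset.mem_sdiff.2 ⟨he, hne⟩, hxe⟩
      rw [← deg_pos] at this
      omega
    obtain ⟨d, hd⟩ := hD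
    obtain ⟨a, b, hab⟩ := G.exists_ends d
    have haD : a ∈ G.vertsOf D := (G.mem_vertsOf D a).2 ⟨d, hd, by simp [hab]⟩
    have haC : a ∈ G.vertsOf C := (G.mem_vertsOf C a).2 ⟨d, hDC hd, by simp [hab]⟩
    have hreach : ∀ x, G.ReachE C a x → x ∈ G.vertsOf D := by
      intro x hx
      induction hx with
      | refl => exact haD
      | tail _ hst ih =>
        obtain ⟨e, he, h1, h2⟩ := hst
        exact (G.mem_vertsOf D _).2 ⟨e, key _ ih e he h1, h2⟩
    refine Finset.Subset.antisymm hDC ?_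
    intro e he
    obtain ⟨x, y, hxy⟩ := G.exists_ends e
    have hxe : x ∈ G.ends e := by simp [hxy]
    have hxC : x ∈ G.vertsOf C := (G.mem_vertsOf C x).2 ⟨e, he, hxe⟩
    exact key x (hreach x (h.2.1 a haC x hxC)) e he hxe
  · rintro ⟨hne, hev, hmin⟩
    refine ⟨hne, ?_, ?_⟩
    · intro u hu w hw
      obtain ⟨D, hDC, h1, h2, h3, h4⟩ := G.comp_deg C u
      obtain ⟨e, he, hue⟩ := (G.mem_vertsOf C u).1 hu
      have heD : e ∈ D := h4 e he ⟨u, hue, Relation.ReflTransGen.refl⟩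
      have hDe : G.EvenSet D := by
        intro x
        by_cases hx : G.ReachE C u x
        · rw [h1 x hx]; exact hev x
        · rw [h2 x hx]; decide
      have hDC' := hmin D hDC ⟨e, heD⟩ hDe
      by_contra hw'
      have h5 := h2 w hw'
      rw [hDC'] at h5
      have := (G.deg_pos C w).2 hw
      omega
    · intro v hv
      obtain ⟨e, he, hve⟩ := (G.mem_vertsOf C v).1 hv
      obtain ⟨x, hx⟩ := Sym2.mem_iff_exists.1 hve
      by_cases hxv : x = v
      · subst hxv
        have h1 : G.EvenSet {e} := by
          intro u
          simp only [deg_eq, Finset.sum_singleton, edeg_eq G hx]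
          split_ifs <;> decide
        have h2 := hmin {e} (by simpa using he) ⟨e, by simp⟩ h1
        rw [← h2]
        simp [deg_eq, edeg_eq G hx]
      · have hreach : G.ReachE (C.erase e) x v := by
          by_contra hr
          obtain ⟨D, hDC, h1, h2, h3, h4⟩ := G.comp_deg (C.erase e) x
          have hE : ∀ u, G.edeg e u + G.deg (C.erase e) u = G.deg C u := G.deg_erase he
          have h5 : G.EvenSet D := by
            apply G.even_of_all_but_one D x
            intro u hu
            by_cases hur : G.ReachE (C.erase e) x u
            · rw [h1 u hur]
              have huv : u ≠ v := by rintro rfl; exact hr hur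
              have h6 := hE u
              rw [edeg_eq G hx] at h6
              simp only [hu, huv, if_false] at h6
              have h7 := hev u
              rw [← h6] at h7
              simpa using h7
            · rw [h2 u hur]; decide
          have h6 := h5 x
          rw [h1 x Relation.ReflTransGen.refl] at h6
          have h7 := hE x
          rw [edeg_eq G hx] at h7
          simp only [hxv, if_true, if_false] at h7
          have h8 := hev x
          rw [← h7] at h8
          rw [Nat.even_iff] at h6 h8
          omega
        obtain ⟨A, hA, hAe, hAv⟩ := G.exists_join hreach
        have heA : e ∉ A := fun h => by simpa using hA h
        have h1 : G.EvenSet (insert e A) := by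
          intro u
          rw [G.deg_insert heA, edeg_eq G hx]
          have := hAe u
          rw [Nat.even_iff] at this ⊢
          omega
        have h2 := hmin (insert e A)
          (Finset.insert_subset he (hA.trans (Finset.erase_subset _ _))) ⟨e, by simp⟩ h1
        rw [← h2, G.deg_insert heA, edeg_eq G hx, hAv hxv]
        simp [Ne.symm hxv]

lemma exists_cycle (G : Multigraph V E) {C : Finset E} (hne : C.Nonempty) (hev : G.EvenSet C) :
    ∃ D ⊆ C, G.IsCycle D := by
  induction C using Finset.strongInduction with
  | H C ih =>
    by_cases h : ∀ D ⊆ C, D.Nonempty → G.EvenSet D → D = C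
    · exact ⟨C, Finset.Subset.refl _, (G.isCycle_iff C).2 ⟨hne, hev, h⟩⟩
    · push Not at h
      obtain ⟨D, hDC, hD, hDe, hne'⟩ := h
      obtain ⟨D', h1, h2⟩ := ih D (Finset.ssubset_iff_subset_ne.2 ⟨hDC, hne'⟩) hD hDe
      exact ⟨D', h1.trans hDC, h2⟩

lemma even_balanced (G : Multigraph V E) (σ : E → ℤˣ) (v : V)
    (hblock : ∀ C : Finset E, G.IsCycle C → v ∉ G.vertsOf C → (∏ e ∈ C, σ e) = 1)
    (C : Finset E) (hev : G.EvenSet C) (hv : v ∉ G.vertsOf C) : ∏ e ∈ C, σ e = 1 := by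
  induction C using Finset.strongInduction with
  | H C ih =>
    rcases C.eq_empty_or_nonempty with rfl | hne
    · simp
    obtain ⟨D, hDC, hD⟩ := G.exists_cycle hne hev
    have hsub : ∀ X ⊆ C, v ∉ G.vertsOf X := by
      intro X hX hvX
      obtain ⟨e, he, h⟩ := (G.mem_vertsOf X v).1 hvX
      exact hv ((G.mem_vertsOf C v).2 ⟨e, hX he, h⟩)
    rw [← Finset.prod_sdiff hDC, hblock D hD (hsub D hDC),
      ih (C \ D) (Finset.sdiff_ssubset hDC hD.1) (hev.sdiff hD.even hDC)
        (hsub _ Finset.sdiff_subset), mul_one]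

lemma switchSign_eq (G : Multigraph V E) (σ : E → ℤˣ) (δ : V → ℤˣ) {e : E} {a b : V}
    (h : G.ends e = s(a, b)) : G.switchSign σ δ e = δ a * δ b * σ e := by
  unfold switchSign; rw [h]; rfl

lemma prod_switch (G : Multigraph V E) (σ : E → ℤˣ) (δ : V → ℤˣ) {C : Finset E}
    (hev : G.EvenSet C) : ∏ e ∈ C, G.switchSign σ δ e = ∏ e ∈ C, σ e := by
  have h1 : ∀ e, G.switchSign σ δ e = (∏ u, δ u ^ G.edeg e u) * σ e := by
    intro e
    obtain ⟨a, b, h⟩ := G.exists_ends e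
    rw [switchSign_eq G σ δ h]
    simp only [edeg_eq G h, pow_add, Finset.prod_mul_distrib]
    simp
  simp only [h1, Finset.prod_mul_distrib]
  rw [Finset.prod_comm]
  have h2 : ∀ u, ∏ e ∈ C, δ u ^ G.edeg e u = 1 := by
    intro u
    rw [Finset.prod_pow_eq_pow_sum, ← deg_eq]
    obtain ⟨k, hk⟩ := hev u
    rw [hk, ← two_mul, pow_mul, Int.units_sq, one_pow]
  simp [h2]

open Classical in
lemma exists_switch (G : Multigraph V E) (σ : E → ℤˣ) (F : Finset E)
    (hbal : ∀ C ⊆ F, G.EvenSet C → ∏ e ∈ C, σ e = 1) :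
    ∃ δ : V → ℤˣ, ∀ e ∈ F, G.switchSign σ δ e = 1 := by
  induction F using Finset.induction_on with
  | empty => exact ⟨fun _ => 1, by simp⟩
  | insert e F he ih =>
    obtain ⟨δ, hδ⟩ := ih (fun C hC => hbal C (hC.trans (Finset.subset_insert _ _)))
    obtain ⟨a, b, hab⟩ := G.exists_ends e
    by_cases hr : G.ReachE F a b
    · refine ⟨δ, ?_⟩
      obtain ⟨A, hA, hAe, -⟩ := G.exists_join hr
      have heA : e ∉ A := fun h => he (hA h)
      have h1 : G.EvenSet (insert e A) := by
        intro u
        rw [G.deg_insert heA, edeg_eq G hab]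
        have := hAe u
        rw [Nat.even_iff] at this ⊢
        omega
      have h2 := hbal (insert e A) (Finset.insert_subset_insert _ hA) h1
      rw [← G.prod_switch σ δ h1, Finset.prod_insert heA,
        Finset.prod_eq_one (fun f hf => hδ f (hA hf)), mul_one] at h2
      intro f hf
      rcases Finset.mem_insert.1 hf with rfl | hf
      · exact h2
      · exact hδ f hf
    · refine ⟨fun u => if G.ReachE F a u then G.switchSign σ δ e * δ u else δ u, ?_⟩
      intro f hf
      rcases Finset.mem_insert.1 hf with rfl | hf
      · have haa : G.ReachE F a a := Relation.ReflTransGen.refl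
        rw [switchSign_eq G σ _ hab]
        simp only [hr, haa, if_true, if_false]
        rw [mul_assoc, mul_assoc, ← mul_assoc (δ a), ← switchSign_eq G σ δ hab]
        exact Int.units_mul_self _
      · obtain ⟨x, y, hxy⟩ := G.exists_ends f
        have h1 : G.ReachE F a x ↔ G.ReachE F a y :=
          ⟨G.reach_step hf (by simp [hxy]) (by simp [hxy]),
           G.reach_step hf (by simp [hxy]) (by simp [hxy])⟩
        have h2 := hδ f hf
        rw [switchSign_eq G σ _ hxy] at h2 ⊢
        by_cases hx : G.ReachE F a x
        · have hy := h1.1 hx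
          simp only [hx, hy, if_true]
          rw [mul_mul_mul_comm, Int.units_mul_self, one_mul, h2]
        · have hy : ¬ G.ReachE F a y := fun h => hx (h1.2 h)
          simp only [hx, hy, if_false]
          exact h2

/-- Pinch lifting of one edge. -/
lemma exists_lift (v : V) (z : Sym2 V) (s : ℤˣ) (h : v ∉ z → s = 1) :
    ∃ t : Sym2 (V ⊕ Unit), z = Sym2.map (Sum.elim id fun _ => v) t ∧
      (s = if Sum.inr () ∈ t then -1 else 1) ∧ t ≠ s(Sum.inr (), Sum.inr ()) := by
  by_cases hv : v ∈ z
  · obtain ⟨x, rfl⟩ := Sym2.mem_iff_exists.1 hv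
    rcases Int.units_eq_one_or s with rfl | rfl
    · exact ⟨s(Sum.inl v, Sum.inl x), by simp, by simp, by simp⟩
    · exact ⟨s(Sum.inr (), Sum.inl x), by simp, by simp, by simp⟩
  · have hs := h hv
    subst hs
    induction z using Sym2.ind with
    | _ a b => exact ⟨s(Sum.inl a, Sum.inl b), by simp, by simp, by simp⟩

lemma pinch_even (Γ : Multigraph V E) (H : Multigraph (V ⊕ Unit) E) (v : V) (s : E → ℤˣ)
    (h1 : ∀ e, Γ.ends e = Sym2.map (Sum.elim id fun _ => v) (H.ends e))
    (h2 : ∀ e, s e = if Sum.inr () ∈ H.ends e then -1 else 1)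
    (h3 : ∀ e, H.ends e ≠ s(Sum.inr (), Sum.inr ())) (C : Finset E) :
    H.EvenSet C ↔ Γ.EvenSet C ∧ ∏ e ∈ C, s e = 1 := by
  have e1 : ∀ e u, u ≠ v → H.edeg e (Sum.inl u) = Γ.edeg e u := by
    intro e u hu
    obtain ⟨p, q, hpq⟩ := H.exists_ends e
    have hz := h1 e
    rw [hpq, Sym2.map_mk] at hz
    rw [edeg_eq H hpq, edeg_eq Γ hz]
    rcases p with p | p <;> rcases q with q | q <;> simp [hu] <;> congr
  have e2 : ∀ e, H.edeg e (Sum.inl v) + H.edeg e (Sum.inr ()) = Γ.edeg e v := by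
    intro e
    obtain ⟨p, q, hpq⟩ := H.exists_ends e
    have hz := h1 e
    rw [hpq, Sym2.map_mk] at hz
    rw [edeg_eq H hpq, edeg_eq H hpq, edeg_eq Γ hz]
    rcases p with p | p <;> rcases q with q | q <;> simp [add_comm] <;> congr
  have e3 : ∀ e, s e = (-1) ^ H.edeg e (Sum.inr ()) := by
    intro e
    have hz := h2 e
    have h3' := h3 e
    obtain ⟨p, q, hpq⟩ := H.exists_ends e
    rw [hz, edeg_eq H hpq]
    rw [hpq] at h3' ⊢
    rcases p with p | p <;> rcases q with q | q <;> simp_all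
  have d1 : ∀ u, u ≠ v → H.deg C (Sum.inl u) = Γ.deg C u := by
    intro u hu
    simp only [deg_eq]
    exact Finset.sum_congr rfl (fun e _ => e1 e u hu)
  have d2 : H.deg C (Sum.inl v) + H.deg C (Sum.inr ()) = Γ.deg C v := by
    simp only [deg_eq]
    rw [← Finset.sum_add_distrib]
    exact Finset.sum_congr rfl (fun e _ => e2 e)
  have d3 : ∏ e ∈ C, s e = 1 ↔ Even (H.deg C (Sum.inr ())) := by
    simp only [e3]
    rw [Finset.prod_pow_eq_pow_sum, ← deg_eq]
    rcases Nat.even_or_odd (H.deg C (Sum.inr ())) with h | h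
    · simp [h]
    · rw [h.neg_one_pow]
      simp only [Nat.not_even_iff_odd.2 h, iff_false]
      decide
  rw [d3]
  constructor
  · intro h
    refine ⟨?_, h _⟩
    intro u
    by_cases hu : u = v
    · subst hu; rw [← d2]; exact (h _).add (h _)
    · rw [← d1 u hu]; exact h _
  · rintro ⟨h, h'⟩ (u | u)
    · by_cases hu : u = v
      · subst hu
        have := h u
        rw [← d2] at this
        exact (Nat.even_add.1 this).2 h'
      · rw [d1 u hu]; exact h u
    · exact h'

lemma reachE_mono (G : Multigraph V E) {A B : Finset E} (h : A ⊆ B) {x y : V}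
    (hr : G.ReachE A x y) : G.ReachE B x y :=
  Relation.ReflTransGen.mono (fun _ _ ⟨e, he, h'⟩ => ⟨e, h he, h'⟩) _ _ hr

lemma path_union (G : Multigraph V E) {P Q : Finset E} {u w : V} (hP : G.IsPath P u w)
    (hQ : G.IsPath Q u w) (hd : Disjoint P Q) (hv : G.vertsOf P ∩ G.vertsOf Q = {u, w}) :
    G.IsCycle (P ∪ Q) := by
  obtain ⟨hne, hPc, huP, hwP, hPu, hPw, hPd⟩ := hP
  obtain ⟨-, hQc, huQ, hwQ, hQu, hQw, hQd⟩ := hQ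
  have hmem : ∀ x, x ∈ G.vertsOf (P ∪ Q) → x ∈ G.vertsOf P ∨ x ∈ G.vertsOf Q := by
    intro x hx
    rw [← deg_pos, G.deg_union hd] at hx
    simp only [← deg_pos]
    omega
  refine ⟨?_, ?_, ?_⟩
  · obtain ⟨e, he, -⟩ := (G.mem_vertsOf P u).1 huP
    exact ⟨e, Finset.mem_union_left _ he⟩
  · intro x hx y hy
    have h1 : G.ReachE (P ∪ Q) x u := by
      rcases hmem x hx with h | h
      · exact G.reachE_mono Finset.subset_union_left (hPc x h u huP)
      · exact G.reachE_mono Finset.subset_union_right (hQc x h u huQ)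
    have h2 : G.ReachE (P ∪ Q) u y := by
      rcases hmem y hy with h | h
      · exact G.reachE_mono Finset.subset_union_left (hPc u huP y h)
      · exact G.reachE_mono Finset.subset_union_right (hQc u huQ y h)
    exact Relation.ReflTransGen.trans h1 h2
  · intro x hx
    rw [G.deg_union hd]
    by_cases hxu : x = u
    · subst hxu; omega
    by_cases hxw : x = w
    · subst hxw; omega
    have hnot : ¬ (x ∈ G.vertsOf P ∧ x ∈ G.vertsOf Q) := by
      rw [← Finset.mem_inter, hv]; simp [hxu, hxw]
    rcases hmem x hx with h | h
    · rw [hPd x h hxu hxw, G.deg_zero (fun h' => hnot ⟨h, h'⟩)]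
    · rw [hQd x h hxu hxw, G.deg_zero (fun h' => hnot ⟨h', h⟩)]

lemma IsCycle.min {G : Multigraph V E} {C D : Finset E} (h : G.IsCycle C) (hDC : D ⊆ C)
    (hD : G.EvenSet D) : D = ∅ ∨ D = C := by
  rcases D.eq_empty_or_nonempty with hemp | hne
  · exact Or.inl hemp
  · exact Or.inr (((G.isCycle_iff C).1 h).2.2 D hDC hne hD)

/-- With a blocking vertex, the frame circuits are the minimal nonempty balanced even sets. -/
lemma frame_iff (Γ : Multigraph V E) (σ : E → ℤˣ) (v : V)
    (hblock : ∀ C : Finset E, Γ.IsCycle C → v ∉ Γ.vertsOf C → (∏ e ∈ C, σ e) = 1)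
    (C : Finset E) :
    Γ.SFrameCircuit σ C ↔ C.Nonempty ∧ (Γ.EvenSet C ∧ ∏ e ∈ C, σ e = 1) ∧
      ∀ D ⊆ C, D.Nonempty → (Γ.EvenSet D ∧ ∏ e ∈ D, σ e = 1) → D = C := by
  have neg : ∀ D, Γ.IsCycle D → D ∉ Γ.balancedCycles σ → ∏ e ∈ D, σ e = -1 := by
    intro D hD h
    rcases Int.units_eq_one_or (∏ e ∈ D, σ e) with h' | h'
    · exact absurd ⟨hD, h'⟩ h
    · exact h'
  have throughv : ∀ D, Γ.IsCycle D → ∏ e ∈ D, σ e = -1 → v ∈ Γ.vertsOf D := by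
    intro D hD h
    by_contra h'
    rw [hblock D hD h'] at h
    exact absurd h (by decide)
  constructor
  · rintro (⟨hC, -, hb⟩ | ⟨C₁, C₂, ⟨hC₁, hC₂, hd, hcard⟩, hb₁, hb₂, rfl⟩ |
      ⟨C₁, C₂, P, ⟨hC₁, hC₂, hd, -⟩, hb₁, hb₂, rfl⟩ | ⟨⟨u, w, P₁, P₂, P₃, hθ, rfl⟩, hun⟩)
    · have := (Γ.isCycle_iff C).1 hC
      exact ⟨this.1, ⟨this.2.1, hb⟩, fun D h1 h2 h3 => this.2.2 D h1 h2 h3.1⟩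
    · have n1 := neg C₁ hC₁ hb₁
      have n2 := neg C₂ hC₂ hb₂
      refine ⟨hC₁.1.mono Finset.subset_union_left, ⟨hC₁.even.union hC₂.even hd, ?_⟩, ?_⟩
      · rw [Finset.prod_union hd, n1, n2]; decide
      · intro D hDC hD ⟨hDe, hDb⟩
        obtain ⟨x, hx⟩ := Finset.card_eq_one.1 hcard
        have hdD : Disjoint (D ∩ C₁) (D ∩ C₂) :=
          Finset.disjoint_of_subset_left Finset.inter_subset_right
            (Finset.disjoint_of_subset_right Finset.inter_subset_right hd)
        have hDu : D = (D ∩ C₁) ∪ (D ∩ C₂) := by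
          rw [← Finset.inter_union_distrib_left]; exact (Finset.inter_eq_left.2 hDC).symm
        have hdeg : ∀ u, Γ.deg D u = Γ.deg (D ∩ C₁) u + Γ.deg (D ∩ C₂) u := by
          intro u
          rw [← Γ.deg_union hdD, ← hDu]
        have z : ∀ X u, u ∉ Γ.vertsOf X → Γ.deg (D ∩ X) u = 0 := by
          intro X u hu
          have h1 := Γ.deg_mono (Finset.inter_subset_right : D ∩ X ⊆ X) u
          rw [Γ.deg_zero hu] at h1
          omega
        have ev : ∀ u, u ≠ x → Even (Γ.deg (D ∩ C₁) u) ∧ Even (Γ.deg (D ∩ C₂) u) := by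
          intro u hu
          have h0 := hDe u
          rw [hdeg u] at h0
          by_cases hu1 : u ∈ Γ.vertsOf C₁
          · have hu2 : u ∉ Γ.vertsOf C₂ := by
              intro hu2
              have := Finset.mem_inter.2 ⟨hu1, hu2⟩
              rw [hx, Finset.mem_singleton] at this
              exact hu this
            rw [z C₂ u hu2] at h0 ⊢
            exact ⟨by simpa using h0, by decide⟩
          · rw [z C₁ u hu1] at h0 ⊢
            exact ⟨by decide, by simpa using h0⟩
        have ev1 := Γ.even_of_all_but_one (D ∩ C₁) x (fun u hu => (ev u hu).1)
        have ev2 := Γ.even_of_all_but_one (D ∩ C₂) x (fun u hu => (ev u hu).2)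
        rcases hC₁.min Finset.inter_subset_right ev1 with h1 | h1 <;>
          rcases hC₂.min Finset.inter_subset_right ev2 with h2 | h2
        · rw [h1, h2] at hDu
          simp [hDu] at hD
        · rw [h1, h2, Finset.empty_union] at hDu
          rw [hDu, n2] at hDb
          exact absurd hDb (by decide)
        · rw [h1, h2, Finset.union_empty] at hDu
          rw [hDu, n1] at hDb
          exact absurd hDb (by decide)
        · rw [h1, h2] at hDu
          exact hDu
    · exact absurd (throughv C₂ hC₂ (neg C₂ hC₂ hb₂))
        (Finset.disjoint_left.1 hd (throughv C₁ hC₁ (neg C₁ hC₁ hb₁)))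
    · exfalso
      obtain ⟨p1, p2, p3, d12, d13, d23, v12, v13, v23⟩ := hθ
      have c12 := Γ.path_union p1 p2 d12 v12
      have c13 := Γ.path_union p1 p3 d13 v13
      have c23 := Γ.path_union p2 p3 d23 v23
      have n12 := neg _ c12 (hun _ (by intro e; simp; tauto) c12)
      have n13 := neg _ c13 (hun _ (by intro e; simp; tauto) c13)
      have n23 := neg _ c23 (hun _ (by intro e; simp; tauto) c23)
      rw [Finset.prod_union d12] at n12
      rw [Finset.prod_union d13] at n13
      rw [Finset.prod_union d23] at n23
      rcases Int.units_eq_one_or (∏ e ∈ P₁, σ e) with h1 | h1 <;>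
      rcases Int.units_eq_one_or (∏ e ∈ P₂, σ e) with h2 | h2 <;>
      rcases Int.units_eq_one_or (∏ e ∈ P₃, σ e) with h3 | h3 <;>
      rw [h1, h2] at n12 <;> rw [h1, h3] at n13 <;> rw [h2, h3] at n23 <;>
      revert n12 n13 n23 <;> decide
  · rintro ⟨hne, ⟨hev, hb⟩, hmin⟩
    by_cases hC : Γ.IsCycle C
    · exact Or.inl ⟨hC, hC, hb⟩
    · right; left
      have unb : ∀ D ⊆ C, Γ.IsCycle D → ∏ e ∈ D, σ e = -1 := by
        intro D hDC hD
        rcases Int.units_eq_one_or (∏ e ∈ D, σ e) with h' | h'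
        · have := hmin D hDC hD.1 ⟨hD.even, h'⟩
          subst this
          exact absurd hD hC
        · exact h'
      obtain ⟨C₁, h1C, hC₁⟩ := Γ.exists_cycle hne hev
      have n1 := unb C₁ h1C hC₁
      have hne' : (C \ C₁).Nonempty := by
        rw [Finset.sdiff_nonempty]
        intro h
        have := Finset.Subset.antisymm h h1C
        subst this
        exact hC hC₁
      obtain ⟨C₂, h2C', hC₂⟩ := Γ.exists_cycle hne' (hev.sdiff hC₁.even h1C)
      have h2C : C₂ ⊆ C := h2C'.trans Finset.sdiff_subset
      have n2 := unb C₂ h2C hC₂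
      have hd : Disjoint C₁ C₂ :=
        Finset.disjoint_of_subset_right h2C' Finset.disjoint_sdiff
      have hu : C₁ ∪ C₂ = C := by
        apply hmin _ (Finset.union_subset h1C h2C) (hC₁.1.mono Finset.subset_union_left)
        refine ⟨hC₁.even.union hC₂.even hd, ?_⟩
        rw [Finset.prod_union hd, n1, n2]; decide
      have v1 := throughv C₁ hC₁ n1
      have v2 := throughv C₂ hC₂ n2
      refine ⟨C₁, C₂, ⟨hC₁, hC₂, hd, ?_⟩, ?_, ?_, hu.symm⟩
      · rw [Finset.card_eq_one]
        refine ⟨v, ?_⟩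
        ext x
        rw [Finset.mem_inter, Finset.mem_singleton]
        constructor
        · rintro ⟨x1, x2⟩
          by_contra hxv
          obtain ⟨A₁, hA₁, hA₁e, hA₁x⟩ := Γ.exists_join (hC₁.2.1 v v1 x x1)
          obtain ⟨A₂, hA₂, hA₂e, hA₂x⟩ := Γ.exists_join (hC₂.2.1 v v2 x x2)
          have a1 := hA₁x (Ne.symm hxv)
          have bad : ∀ B ⊆ C₂,
              (∀ u, Even (Γ.deg B u + (if u = v then 1 else 0) + (if u = x then 1 else 0))) →
              (∏ e ∈ A₁, σ e) * (∏ e ∈ B, σ e) = 1 → False := by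
            intro B hB hBe hs
            have hdB : Disjoint A₁ B :=
              Finset.disjoint_of_subset_left hA₁ (Finset.disjoint_of_subset_right hB hd)
            have hA₁ne : A₁.Nonempty := by
              rw [Finset.nonempty_iff_ne_empty]
              rintro rfl
              simp [deg_eq] at a1
            have heq : A₁ ∪ B = C := by
              apply hmin _ (Finset.union_subset (hA₁.trans h1C) (hB.trans h2C))
                (hA₁ne.mono Finset.subset_union_left)
              refine ⟨?_, by rw [Finset.prod_union hdB, hs]⟩
              intro u
              rw [Γ.deg_union hdB]
              have e1 := hA₁e u
              have e2 := hBe u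
              rw [Nat.even_iff] at e1 e2 ⊢
              omega
            have hAC : A₁ = C₁ := by
              refine Finset.Subset.antisymm hA₁ ?_
              intro e he
              have : e ∈ A₁ ∪ B := by rw [heq]; exact h1C he
              rcases Finset.mem_union.1 this with h | h
              · exact h
              · exact absurd (hB h) (Finset.disjoint_left.1 hd he)
            have := hC₁.even x
            rw [← hAC, a1] at this
            exact absurd this (by decide)
          have hs2 := Finset.prod_sdiff (f := σ) hA₂
          rw [n2] at hs2
          rcases Int.units_eq_one_or ((∏ e ∈ A₁, σ e) * (∏ e ∈ A₂, σ e)) with h | h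
          · exact bad A₂ hA₂ hA₂e h
          · refine bad (C₂ \ A₂) Finset.sdiff_subset ?_ ?_
            · intro u
              have e1 := hA₂e u
              have e2 := Γ.deg_sdiff hA₂ u
              have e3 := hC₂.even u
              rw [Nat.even_iff] at e1 e3 ⊢
              omega
            · generalize (∏ e ∈ A₁, σ e) = p at *
              generalize (∏ e ∈ A₂, σ e) = q at *
              generalize (∏ e ∈ C₂ \ A₂, σ e) = r at *
              clear bad
              revert p q r
              decide
        · rintro rfl
          exact ⟨v1, v2⟩
      · rintro ⟨-, h⟩
        rw [n1] at h
        exact absurd h (by decide)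
      · rintro ⟨-, h⟩
        rw [n2] at h
        exact absurd h (by decide)

end Multigraph

/-- An unbalanced signed graph with a blocking vertex whose frame
matroid is `M(G)` for a 2-connected `G` is obtained, up to switching, by a
pinch of a graph `H` that is 2-isomorphic to `G` (2-isomorphism expressed, via
Whitney's theorem, as equality of cycle matroids on the common edge set). -/
theorem blocking_vertex_gives_pinch {W : Type} [Fintype W] [DecidableEq W]
    (Γ : Multigraph V E) (σ : E → ℤˣ)
    (hunb : ∃ C : Finset E, Γ.IsCycle C ∧ (∏ e ∈ C, σ e) ≠ 1)
    (v : V)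
    (hblock : ∀ C : Finset E, Γ.IsCycle C → v ∉ Γ.vertsOf C → (∏ e ∈ C, σ e) = 1)
    (G : Multigraph W E) (hG2 : G.TwoConnected)
    (hFM : ∀ C : Finset E, Γ.SFrameCircuit σ C ↔ G.IsCycle C) :
    ∃ (H : Multigraph (V ⊕ Unit) E) (δ : V → ℤˣ),
      (∀ C : Finset E, H.IsCycle C ↔ G.IsCycle C) ∧
      (∀ e, Γ.ends e = Sym2.map (Sum.elim id fun _ => v) (H.ends e)) ∧
      (∀ e, Γ.switchSign σ δ e = if Sum.inr () ∈ H.ends e then -1 else 1) := by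
  classical
  obtain ⟨δ, hδ⟩ := Γ.exists_switch σ (Finset.univ.filter fun e => v ∉ Γ.ends e) (by
    intro C hC hev
    apply Γ.even_balanced σ v hblock C hev
    rw [Multigraph.mem_vertsOf]
    rintro ⟨e, he, hve⟩
    exact (Finset.mem_filter.1 (hC he)).2 hve)
  have hlift := fun e => Multigraph.exists_lift v (Γ.ends e) (Γ.switchSign σ δ e)
    (fun h => hδ e (Finset.mem_filter.2 ⟨Finset.mem_univ _, h⟩))
  choose t h1 h2 h3 using hlift
  refine ⟨⟨t⟩, δ, ?_, h1, h2⟩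
  intro C
  have hev : ∀ D : Finset E, (⟨t⟩ : Multigraph (V ⊕ Unit) E).EvenSet D ↔
      Γ.EvenSet D ∧ ∏ e ∈ D, σ e = 1 := by
    intro D
    rw [Multigraph.pinch_even Γ ⟨t⟩ v (Γ.switchSign σ δ) h1 h2 h3 D]
    constructor
    · rintro ⟨a, b⟩
      exact ⟨a, by rwa [Γ.prod_switch σ δ a] at b⟩
    · rintro ⟨a, b⟩
      exact ⟨a, by rwa [Γ.prod_switch σ δ a]⟩
  rw [← hFM C, Multigraph.frame_iff Γ σ v hblock C, Multigraph.isCycle_iff]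
  simp only [hev]
end

section
/- Let Ω be an unbalanced signed graph with a blocking vertex v. Then there is a graph H with F(Ω) = M(H) such that the underlying graph Γ of Ω is obtained from H by identifying two vertices v1 and v2 of H into v. -/
variable {V E : Type} [Fintype V] [DecidableEq V] [Fintype E] [DecidableEq E]


namespace BVS

/-- degree contribution -/
def inc (G : Multigraph V E) (e : E) (v : V) : ℕ :=
  if G.ends e = Sym2.diag v then 2 else if v ∈ G.ends e then 1 else 0

lemma inc_eq (G : Multigraph V E) {e : E} {a b : V} (h : G.ends e = s(a, b)) (v : V) :
    inc G e v = (if a = v then 1 else 0) + (if b = v then 1 else 0) := by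
  unfold inc
  rw [h]
  by_cases h1 : a = v <;> by_cases h2 : b = v <;> simp [Sym2.diag, h1, h2] <;> grind

lemma exists_ends (G : Multigraph V E) (e : E) : ∃ a b, G.ends e = s(a, b) := by
  induction h : G.ends e with
  | _ a b => exact ⟨a, b, rfl⟩

lemma deg_eq (G : Multigraph V E) (C : Finset E) (v : V) : G.deg C v = ∑ e ∈ C, inc G e v := rfl

lemma inc_pos (G : Multigraph V E) {e : E} {v : V} : 0 < inc G e v ↔ v ∈ G.ends e := by
  obtain ⟨a, b, h⟩ := exists_ends G e
  rw [inc_eq G h, h, Sym2.mem_iff]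
  by_cases h1 : a = v <;> by_cases h2 : b = v <;> simp [h1, h2] <;> grind

lemma inc_zero (G : Multigraph V E) {e : E} {v : V} (h : v ∉ G.ends e) : inc G e v = 0 := by
  rw [← inc_pos] at h; omega

lemma mem_verts (G : Multigraph V E) {C : Finset E} {v : V} :
    v ∈ G.vertsOf C ↔ ∃ e ∈ C, v ∈ G.ends e := by
  simp [Multigraph.vertsOf]

/-- mod 2 degree -/
def par (G : Multigraph V E) (C : Finset E) (v : V) : ZMod 2 := ∑ e ∈ C, (inc G e v : ZMod 2)

lemma par_eq (G : Multigraph V E) (C : Finset E) (v : V) : par G C v = (G.deg C v : ZMod 2) := by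
  rw [deg_eq, par]; push_cast; rfl

/-- even edge sets -/
def Ev (G : Multigraph V E) (C : Finset E) : Prop := ∀ v, par G C v = 0

lemma z2 (x : ZMod 2) : x + x = 0 := CharTwo.add_self_eq_zero x

lemma z2cases (x : ZMod 2) : x = 0 ∨ x = 1 := by
  revert x; decide

lemma sum_symmDiff (f : E → ZMod 2) (A B : Finset E) :
    ∑ e ∈ symmDiff A B, f e = ∑ e ∈ A, f e + ∑ e ∈ B, f e := by
  have h1 : ∑ e ∈ A, f e = ∑ e ∈ A \ B, f e + ∑ e ∈ A ∩ B, f e := by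
    rw [add_comm, Finset.sum_inter_add_sum_sdiff]
  have h2 : ∑ e ∈ B, f e = ∑ e ∈ B \ A, f e + ∑ e ∈ A ∩ B, f e := by
    rw [add_comm, Finset.inter_comm, Finset.sum_inter_add_sum_sdiff]
  have h3 : symmDiff A B = (A \ B) ∪ (B \ A) := rfl
  rw [h3, Finset.sum_union (by
    rw [Finset.disjoint_left]; intro x; simp only [Finset.mem_sdiff]; tauto), h1, h2]
  have := z2 (∑ e ∈ A ∩ B, f e)
  linear_combination -this

lemma par_symmDiff (G : Multigraph V E) (A B : Finset E) (v : V) :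
    par G (symmDiff A B) v = par G A v + par G B v := sum_symmDiff _ A B

lemma sum_sdiff' (f : E → ZMod 2) {A B : Finset E} (h : B ⊆ A) :
    ∑ e ∈ A \ B, f e = ∑ e ∈ A, f e + ∑ e ∈ B, f e := by
  rw [← Finset.sum_sdiff h]
  have := z2 (∑ e ∈ B, f e)
  linear_combination -this

/-- minimal nonempty even -/
def MinEv (G : Multigraph V E) (C : Finset E) : Prop :=
  C.Nonempty ∧ Ev G C ∧ ∀ D ⊆ C, D.Nonempty → Ev G D → D = C

lemma edge_of_mem (G : Multigraph V E) {e : E} {a b : V} (hab : a ≠ b) (ha : a ∈ G.ends e)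
    (hb : b ∈ G.ends e) : G.ends e = s(a, b) := (Sym2.mem_and_mem_iff hab).1 ⟨ha, hb⟩

lemma par_single (G : Multigraph V E) {e : E} {a b : V} (h : G.ends e = s(a, b)) (v : V) :
    par G {e} v = (if a = v then 1 else 0) + (if b = v then 1 else 0) := by
  simp [par, inc_eq G h]

lemma reach_symm (G : Multigraph V E) {C : Finset E} {u w : V} (h : G.ReachE C u w) :
    G.ReachE C w u := by
  unfold Multigraph.ReachE at *
  induction h with
  | refl => exact .refl
  | tail _ h2 ih =>
    obtain ⟨e, he, h1, h2⟩ := h2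
    exact .head ⟨e, he, h2, h1⟩ ih

lemma tjoin (G : Multigraph V E) {C : Finset E} {u w : V} (h : G.ReachE C u w) :
    ∃ J ⊆ C, ∀ x, par G J x = (if u = x then 1 else 0) + (if w = x then 1 else 0) := by
  unfold Multigraph.ReachE at h
  induction h with
  | refl => exact ⟨∅, by simp, fun x => by simp [par, z2]⟩
  | @tail a b _ h2 ih =>
    obtain ⟨J, hJ, hp⟩ := ih
    obtain ⟨e, he, ha, hb⟩ := h2
    by_cases hab : a = b
    · subst hab; exact ⟨J, hJ, hp⟩
    refine ⟨symmDiff J {e}, ?_, fun x => ?_⟩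
    · intro y; simp only [Finset.mem_symmDiff, Finset.mem_singleton]
      rintro (h | h)
      · exact hJ h.1
      · rw [h.1]; exact he
    · rw [par_symmDiff, hp, par_single G (edge_of_mem G hab ha hb)]
      have := z2 (if a = x then 1 else 0)
      linear_combination this

/-- handshake on a closed set -/
lemma handshake (G : Multigraph V E) (C : Finset E) (S : Finset V)
    (hS : ∀ e ∈ C, ∀ a ∈ G.ends e, ∀ b ∈ G.ends e, a ∈ S → b ∈ S) :
    ∑ u ∈ S, par G C u = 0 := by
  unfold par
  rw [Finset.sum_comm]
  apply Finset.sum_eq_zero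
  intro e he
  obtain ⟨a, b, h⟩ := exists_ends G e
  have h1 := hS e he a (by simp [h]) b (by simp [h])
  have h2 := hS e he b (by simp [h]) a (by simp [h])
  simp only [inc_eq G h, Nat.cast_add, Finset.sum_add_distrib, Nat.cast_ite, Nat.cast_one,
    Nat.cast_zero, Finset.sum_ite_eq]
  by_cases ha : a ∈ S
  · simp [ha, h1 ha, z2]
  · have : b ∉ S := fun hb => ha (h2 hb)
    simp [ha, this]

lemma cycle_even (G : Multigraph V E) {C : Finset E} (h : G.IsCycle C) : Ev G C := by
  intro v
  rw [par_eq]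
  by_cases hv : v ∈ G.vertsOf C
  · rw [h.2.2 v hv]; rfl
  · have : G.deg C v = 0 := by
      rw [deg_eq]; apply Finset.sum_eq_zero
      intro e he; apply inc_zero; intro h'; exact hv ((mem_verts G).2 ⟨e, he, h'⟩)
    simp [this]

lemma deg_pos (G : Multigraph V E) {C : Finset E} {v : V} (h : v ∈ G.vertsOf C) :
    0 < G.deg C v := by
  obtain ⟨e, he, hv⟩ := (mem_verts G).1 h
  rw [deg_eq]
  exact Finset.sum_pos' (fun _ _ => Nat.zero_le _) ⟨e, he, (inc_pos G).2 hv⟩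

lemma cycle_minEv (G : Multigraph V E) {C : Finset E} (h : G.IsCycle C) : MinEv G C := by
  refine ⟨h.1, cycle_even G h, ?_⟩
  intro D hD hne hev
  have key : ∀ u ∈ G.vertsOf D, ∀ e ∈ C, u ∈ G.ends e → e ∈ D := by
    intro u hu e he hue
    by_contra hn
    have huC : u ∈ G.vertsOf C := (mem_verts G).2 ⟨e, he, hue⟩
    have h1 := h.2.2 u huC
    have h2 := deg_pos G hu
    have h3 : G.deg (insert e D) u ≤ G.deg C u := by
      rw [deg_eq, deg_eq]
      exact Finset.sum_le_sum_of_subset (Finset.insert_subset he hD)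
    rw [deg_eq, Finset.sum_insert hn, ← deg_eq] at h3
    have h4 := (inc_pos G).2 hue
    have h5 : G.deg D u = 1 := by omega
    have := hev u
    rw [par_eq, h5] at this
    simp at this
  obtain ⟨d, hd⟩ := hne
  obtain ⟨a, b, hab⟩ := exists_ends G d
  have haD : a ∈ G.vertsOf D := (mem_verts G).2 ⟨d, hd, by simp [hab]⟩
  have reach : ∀ w, G.ReachE C a w → w ∈ G.vertsOf D := by
    intro w hw
    unfold Multigraph.ReachE at hw
    induction hw with
    | refl => exact haD
    | tail _ h2 ih =>
      obtain ⟨e, he, h1, h2⟩ := h2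
      exact (mem_verts G).2 ⟨e, key _ ih e he h1, h2⟩
  apply Finset.Subset.antisymm hD
  intro e he
  obtain ⟨x, y, hxy⟩ := exists_ends G e
  have hx : x ∈ G.ends e := by simp [hxy]
  have := h.2.1 a ((mem_verts G).2 ⟨d, hD hd, by simp [hab]⟩) x ((mem_verts G).2 ⟨e, he, hx⟩)
  exact key x (reach x this) e he hx

lemma first_hit (G : Multigraph V E) {C : Finset E} {v x w : V} (hx : x ≠ v)
    (h : G.ReachE C x w) :
    (w ≠ v ∧ ∃ J ⊆ C, (∀ e ∈ J, v ∉ G.ends e) ∧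
      ∀ y, par G J y = (if x = y then 1 else 0) + (if w = y then 1 else 0)) ∨
    (∃ J ⊆ C, ∃ f ∈ C, (∀ e ∈ J, v ∉ G.ends e) ∧ inc G f v = 1 ∧
      ∀ y, par G J y + inc G f y = (if x = y then 1 else 0) + (if v = y then 1 else 0)) := by
  unfold Multigraph.ReachE at h
  induction h with
  | refl => exact .inl ⟨hx, ∅, by simp, by simp, fun y => by simp [par, z2]⟩
  | @tail a b _ h2 ih =>
    rcases ih with ⟨hav, J, hJ, hJv, hp⟩ | h
    swap
    · exact .inr h
    obtain ⟨e, he, ha, hb⟩ := h2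
    by_cases hab : a = b
    · subst hab; exact .inl ⟨hav, J, hJ, hJv, hp⟩
    have hends := edge_of_mem G hab ha hb
    by_cases hbv : b = v
    · subst hbv
      refine .inr ⟨J, hJ, e, he, hJv, ?_, fun y => ?_⟩
      · rw [inc_eq G hends]; simp [hab]
      · rw [hp, inc_eq G hends]; push_cast
        have := z2 (if a = y then 1 else 0)
        linear_combination this
    · refine .inl ⟨hbv, symmDiff J {e}, ?_, ?_, fun y => ?_⟩
      · intro y; simp only [Finset.mem_symmDiff, Finset.mem_singleton]
        rintro (h | h)
        · exact hJ h.1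
        · rw [h.1]; exact he
      · intro y; simp only [Finset.mem_symmDiff, Finset.mem_singleton]
        rintro (h | h)
        · exact hJv _ h.1
        · rw [h.1, hends]; simp; exact ⟨fun h => hav h.symm, fun h => hbv h.symm⟩
      · rw [par_symmDiff, hp, par_single G hends]
        have := z2 (if a = y then 1 else 0)
        linear_combination this

open Classical in
lemma minEv_cycle (G : Multigraph V E) {C : Finset E} (h : MinEv G C) : G.IsCycle C := by
  obtain ⟨hne, hev, hmin⟩ := h
  refine ⟨hne, ?_, ?_⟩
  · intro u hu w hw
    set D := C.filter (fun e => ∃ a ∈ G.ends e, G.ReachE C u a) with hD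
    have hDC : D = C := by
      apply hmin D (Finset.filter_subset _ _)
      · obtain ⟨e, he, hue⟩ := (mem_verts G).1 hu
        exact ⟨e, Finset.mem_filter.2 ⟨he, u, hue, .refl⟩⟩
      · intro y
        by_cases hy : G.ReachE C u y
        · rw [← hev y]
          unfold par
          apply Finset.sum_subset (Finset.filter_subset _ _)
          intro e he heD
          rw [inc_zero]
          · rfl
          · intro hye; exact heD (Finset.mem_filter.2 ⟨he, y, hye, hy⟩)
        · apply Finset.sum_eq_zero
          intro e he
          rw [inc_zero]
          · rfl
          · intro hye
            obtain ⟨heC, a, ha, hr⟩ := Finset.mem_filter.1 he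
            exact hy (Relation.ReflTransGen.tail hr ⟨e, heC, ha, hye⟩)
    obtain ⟨e, he, hwe⟩ := (mem_verts G).1 hw
    rw [← hDC] at he
    obtain ⟨heC, a, ha, hr⟩ := Finset.mem_filter.1 he
    exact Relation.ReflTransGen.tail hr ⟨e, heC, ha, hwe⟩
  · intro v hv
    obtain ⟨e, he, hve⟩ := (mem_verts G).1 hv
    obtain ⟨x, hends⟩ : ∃ x, G.ends e = s(v, x) := hve
    by_cases hxv : x = v
    · subst hxv
      have : {e} = C := by
        apply hmin _ (by simpa using he) (by simp)
        intro y; rw [par_single G hends, z2]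
      rw [← this, deg_eq, Finset.sum_singleton, inc_eq G hends]; simp
    · set C' := C \ {e} with hC'
      have hpar : ∀ y, par G C' y = (if v = y then 1 else 0) + (if x = y then 1 else 0) := by
        intro y
        have := sum_sdiff' (fun e => (inc G e y : ZMod 2)) (B := {e}) (A := C) (by simpa using he)
        have h2 := par_single G hends y
        have h3 := hev y
        unfold par at *
        rw [this, h3, h2]; ring
      have hreach : G.ReachE C' x v := by
        by_contra hn
        have := handshake G C' (Finset.univ.filter (fun a => G.ReachE C' x a)) (by
          intro f hf a ha b hb h
          simp only [Finset.mem_filter, Finset.mem_univ, true_and] at *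
          exact Relation.ReflTransGen.tail h ⟨f, hf, ha, hb⟩)
        have hxx : G.ReachE C' x x := .refl
        simp [hpar, Finset.sum_add_distrib, hn, hxx] at this
      rcases first_hit G hxv hreach with ⟨h, _⟩ | ⟨J, hJ, f, hf, hJv, hfv, hp⟩
      · exact absurd rfl h
      have hfJ : f ∉ J := fun h => by
        have := inc_zero G (hJv f h); omega
      have heJ : e ∉ insert f J := by
        intro h
        have : e ∈ C' := by
          rcases Finset.mem_insert.1 h with h | h
          · rw [h]; exact hf
          · exact hJ h
        simp [hC'] at this
      have hfC : f ∈ C := (Finset.mem_sdiff.1 hf).1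
      have hJC : J ⊆ C := fun y hy => (Finset.mem_sdiff.1 (hJ hy)).1
      have : insert e (insert f J) = C := by
        apply hmin
        · exact Finset.insert_subset he (Finset.insert_subset hfC hJC)
        · simp
        · intro y
          have h1 := hp y
          unfold par at *
          rw [Finset.sum_insert heJ, Finset.sum_insert hfJ, inc_eq G hends]
          push_cast
          have h2 := z2 (if v = y then 1 else 0)
          have h3 := z2 (if x = y then 1 else 0)
          linear_combination h1 + h2 + h3
      rw [← this, deg_eq, Finset.sum_insert heJ, Finset.sum_insert hfJ, hfv, inc_eq G hends,
        Finset.sum_eq_zero (fun g hg => inc_zero G (hJv g hg))]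
      simp [hxv]

lemma cycle_iff (G : Multigraph V E) {C : Finset E} : G.IsCycle C ↔ MinEv G C :=
  ⟨cycle_minEv G, minEv_cycle G⟩

lemma exists_cycle (G : Multigraph V E) (D : Finset E) (hne : D.Nonempty) (hev : Ev G D) :
    ∃ C ⊆ D, G.IsCycle C := by
  induction D using Finset.strongInduction with
  | H D ih =>
    by_cases h : MinEv G D
    · exact ⟨D, subset_rfl, minEv_cycle G h⟩
    · unfold MinEv at h
      push Not at h
      obtain ⟨D', h1, h2, h3, h4⟩ := h hne hev
      obtain ⟨C, hC, hc⟩ := ih D' (Finset.ssubset_iff_subset_ne.2 ⟨h1, h4⟩) h2 h3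
      exact ⟨C, hC.trans h1, hc⟩

lemma ev_sdiff (G : Multigraph V E) {A B : Finset E} (h : B ⊆ A) (hA : Ev G A) (hB : Ev G B) :
    Ev G (A \ B) := by
  intro v
  have := sum_sdiff' (fun e => (inc G e v : ZMod 2)) h
  have h1 := hA v
  have h2 := hB v
  unfold par at *
  rw [this, h1, h2, add_zero]

/-- sign as element of ZMod 2 -/
def sg (σ : E → ℤˣ) (e : E) : ZMod 2 := if σ e = 1 then 0 else 1

lemma prod_sg (σ : E → ℤˣ) (C : Finset E) :
    (∏ e ∈ C, σ e = 1 ∧ ∑ e ∈ C, sg σ e = 0) ∨ (∏ e ∈ C, σ e = -1 ∧ ∑ e ∈ C, sg σ e = 1) := by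
  induction C using Finset.induction_on with
  | empty => simp
  | insert a s ha ih =>
    rw [Finset.prod_insert ha, Finset.sum_insert ha]
    have hsg : sg σ a = if σ a = 1 then 0 else 1 := rfl
    have h10 : (1 : ZMod 2) + 1 = 0 := rfl
    have hne : (-1 : ℤˣ) ≠ 1 := by decide
    rcases ih with ⟨h1, h2⟩ | ⟨h1, h2⟩ <;> rcases Int.units_eq_one_or (σ a) with h | h <;>
      simp [hsg, h, h1, h2, h10, hne]

lemma bal_iff (σ : E → ℤˣ) (C : Finset E) : ∏ e ∈ C, σ e = 1 ↔ ∑ e ∈ C, sg σ e = 0 := by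
  have hne : (-1 : ℤˣ) ≠ 1 := by decide
  rcases prod_sg σ C with ⟨h1, h2⟩ | ⟨h1, h2⟩ <;> simp [h1, h2, hne]

lemma even_avoid (G : Multigraph V E) (s : E → ZMod 2) (v : V)
    (hb : ∀ C, G.IsCycle C → v ∉ G.vertsOf C → ∑ e ∈ C, s e = 0) (D : Finset E)
    (hev : Ev G D) (hv : ∀ e ∈ D, v ∉ G.ends e) : ∑ e ∈ D, s e = 0 := by
  induction D using Finset.strongInduction with
  | H D ih =>
    rcases D.eq_empty_or_nonempty with rfl | hne
    · simp
    obtain ⟨C, hC, hc⟩ := exists_cycle G D hne hev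
    have h1 := hb C hc (by
      rw [mem_verts]; rintro ⟨e, he, h⟩; exact hv e (hC he) h)
    have h2 := ih (D \ C) (Finset.sdiff_ssubset hC hc.1) (ev_sdiff G hC hev (cycle_even G hc))
      (fun e he => hv e (Finset.mem_sdiff.1 he).1)
    rw [← Finset.sum_sdiff hC, h1, h2, add_zero]

lemma exists_switch (G : Multigraph V E) (s : E → ZMod 2) (v : V)
    (hb : ∀ D, Ev G D → (∀ e ∈ D, v ∉ G.ends e) → ∑ e ∈ D, s e = 0) :
    ∃ δ : V → ZMod 2, ∀ e a b, G.ends e = s(a, b) → v ∉ G.ends e → s e = δ a + δ b := by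
  let f := Fintype.linearCombination (ZMod 2) (fun (e : {e // v ∉ G.ends e}) (u : V) => (inc G e.1 u : ZMod 2))
  let t := Fintype.linearCombination (ZMod 2) (fun (e : {e // v ∉ G.ends e}) => s e.1)
  have ht : t ∈ (LinearMap.ker f).dualAnnihilator := by
    rw [Submodule.mem_dualAnnihilator]
    intro w hw
    set D : Finset E := (Finset.univ.filter (fun e => w e = 1)).map (Function.Embedding.subtype _) with hD
    have hsum : ∀ g : E → ZMod 2, ∑ e ∈ D, g e = ∑ e, w e * g e.1 := by
      intro g
      rw [hD, Finset.sum_map, Finset.sum_filter]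
      apply Finset.sum_congr rfl
      intro e _
      rcases z2cases (w e) with h | h <;> simp [h]
    have := hb D (by
      intro u
      unfold par
      rw [hsum]
      have := congrFun (LinearMap.mem_ker.1 hw) u
      simpa [f, Fintype.linearCombination_apply] using this) (by
      intro e he
      obtain ⟨e', _, rfl⟩ := Finset.mem_map.1 he
      exact e'.2)
    rw [hsum] at this
    simpa [t, Fintype.linearCombination_apply] using this
  rw [← LinearMap.range_dualMap_eq_dualAnnihilator_ker] at ht
  obtain ⟨δ', hδ⟩ := ht
  refine ⟨fun a => δ' (Pi.single a 1), ?_⟩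
  intro e a b hab hv
  have h1 := LinearMap.congr_fun hδ (Pi.single ⟨e, hv⟩ 1)
  simp only [LinearMap.dualMap_apply, f, t, Fintype.linearCombination_apply_single, one_smul] at h1
  rw [← h1, ← map_add]
  congr 1
  funext u
  simp [inc_eq G hab, Pi.single_apply, eq_comm]

/-- minimal nonempty balanced even set -/
def MinBal (G : Multigraph V E) (s : E → ZMod 2) (C : Finset E) : Prop :=
  C.Nonempty ∧ (Ev G C ∧ ∑ e ∈ C, s e = 0) ∧
    ∀ D ⊆ C, D.Nonempty → (Ev G D ∧ ∑ e ∈ D, s e = 0) → D = C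

lemma exists_split (G : Multigraph V E) (s : E → ZMod 2) (v : V)
    (hb : ∀ D, Ev G D → (∀ e ∈ D, v ∉ G.ends e) → ∑ e ∈ D, s e = 0) :
    ∃ H : Multigraph (V ⊕ Unit) E,
      (∀ e, G.ends e = Sym2.map (Sum.elim id fun _ => v) (H.ends e)) ∧
      ∀ C, Ev H C ↔ (Ev G C ∧ ∑ e ∈ C, s e = 0) := by
  obtain ⟨δ, hδ⟩ := exists_switch G s v hb
  have hab : ∀ e, ∃ a b, G.ends e = s(a, b) ∧ (v ∈ G.ends e → a = v) := by
    intro e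
    by_cases h : v ∈ G.ends e
    · obtain ⟨b, hb⟩ := id h
      exact ⟨v, b, hb, fun _ => rfl⟩
    · obtain ⟨a, b, h'⟩ := exists_ends G e
      exact ⟨a, b, h', fun h'' => absurd h'' h⟩
  choose a b hends hav using hab
  set t : E → ZMod 2 := fun e => s e + (δ (a e) + δ (b e)) with ht
  have htv : ∀ e, t e ≠ 0 → a e = v := by
    intro e h
    apply hav
    by_contra hn
    apply h
    simp only [ht]
    rw [hδ e _ _ (hends e) hn, z2]
  let H : Multigraph (V ⊕ Unit) E :=
    ⟨fun e => if t e = 0 then s(Sum.inl (a e), Sum.inl (b e)) else s(Sum.inr (), Sum.inl (b e))⟩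
  have hH0 : ∀ e, t e = 0 → H.ends e = s(Sum.inl (a e), Sum.inl (b e)) := fun e h => by
    simp [H, h]
  have hH1 : ∀ e, t e ≠ 0 → H.ends e = s(Sum.inr (), Sum.inl (b e)) := fun e h => by
    simp [H, h]
  have hr : ∀ C, par H C (Sum.inr ()) = ∑ e ∈ C, t e := by
    intro C
    apply Finset.sum_congr rfl
    intro e _
    by_cases h : t e = 0
    · rw [inc_eq H (hH0 e h)]; simp [h]
    · rw [inc_eq H (hH1 e h)]
      rcases z2cases (t e) with h' | h'
      · exact absurd h' h
      · simp [h']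
  have hl : ∀ C u, par H C (Sum.inl u) = par G C u + if u = v then ∑ e ∈ C, t e else 0 := by
    intro C u
    have : (if u = v then ∑ e ∈ C, t e else 0) = ∑ e ∈ C, if u = v then t e else 0 := by
      split_ifs <;> simp
    rw [this]
    unfold par
    rw [← Finset.sum_add_distrib]
    apply Finset.sum_congr rfl
    intro e _
    rw [inc_eq G (hends e)]
    by_cases h : t e = 0
    · rw [inc_eq H (hH0 e h)]; simp [h]
    · rw [inc_eq H (hH1 e h), htv e h]
      rcases z2cases (t e) with h' | h'
      · exact absurd h' h
      · by_cases huv : u = v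
        · subst huv
          simp [h']
          have := z2 1
          linear_combination -this
        · simp [h', huv, Ne.symm huv]
  have hts : ∀ C, Ev G C → ∑ e ∈ C, t e = ∑ e ∈ C, s e := by
    intro C hC
    have h1 : ∑ e ∈ C, (δ (a e) + δ (b e)) = ∑ u, δ u * par G C u := by
      unfold par
      simp_rw [Finset.mul_sum]
      rw [Finset.sum_comm]
      apply Finset.sum_congr rfl
      intro e _
      simp [inc_eq G (hends e), mul_add, Finset.sum_add_distrib]
    simp only [ht]
    rw [Finset.sum_add_distrib, h1]
    have h2 : ∑ u, δ u * par G C u = 0 :=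
      Finset.sum_eq_zero (fun u _ => by rw [hC u, mul_zero])
    rw [h2, add_zero]
  refine ⟨H, ?_, ?_⟩
  · intro e
    by_cases h : t e = 0
    · rw [hH0 e h, hends]; simp
    · rw [hH1 e h, hends, htv e h]; simp
  · intro C
    constructor
    · intro h
      have h0 : ∑ e ∈ C, t e = 0 := by rw [← hr]; exact h _
      have hG : Ev G C := by
        intro u
        have := h (Sum.inl u)
        rw [hl, h0] at this
        simpa using this
      exact ⟨hG, by rw [← hts C hG]; exact h0⟩
    · rintro ⟨hG, hs⟩
      rw [← hts C hG] at hs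
      rintro (u | u)
      · rw [hl, hs, hG u]; simp
      · rw [hr, hs]

lemma deg_union (G : Multigraph V E) {A B : Finset E} (h : Disjoint A B) (v : V) :
    G.deg (A ∪ B) v = G.deg A v + G.deg B v := Finset.sum_union h

lemma par_union (G : Multigraph V E) {A B : Finset E} (h : Disjoint A B) (v : V) :
    par G (A ∪ B) v = par G A v + par G B v := Finset.sum_union h

lemma deg_zero (G : Multigraph V E) {A : Finset E} {v : V} (h : v ∉ G.vertsOf A) :
    G.deg A v = 0 := by
  rw [deg_eq]; apply Finset.sum_eq_zero
  intro e he; apply inc_zero; intro h'; exact h ((mem_verts G).2 ⟨e, he, h'⟩)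

lemma verts_union (G : Multigraph V E) {A B : Finset E} {v : V} :
    v ∈ G.vertsOf (A ∪ B) ↔ v ∈ G.vertsOf A ∨ v ∈ G.vertsOf B := by
  simp only [mem_verts, Finset.mem_union]
  constructor
  · rintro ⟨e, h | h, h'⟩
    · exact .inl ⟨e, h, h'⟩
    · exact .inr ⟨e, h, h'⟩
  · rintro (⟨e, h, h'⟩ | ⟨e, h, h'⟩)
    · exact ⟨e, .inl h, h'⟩
    · exact ⟨e, .inr h, h'⟩

lemma verts_mono (G : Multigraph V E) {A B : Finset E} (h : A ⊆ B) {v : V}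
    (hv : v ∈ G.vertsOf A) : v ∈ G.vertsOf B := by
  obtain ⟨e, he, h'⟩ := (mem_verts G).1 hv
  exact (mem_verts G).2 ⟨e, h he, h'⟩

lemma reach_mono (G : Multigraph V E) {A B : Finset E} (h : A ⊆ B) {u w : V}
    (hr : G.ReachE A u w) : G.ReachE B u w := by
  unfold Multigraph.ReachE at *
  induction hr with
  | refl => exact .refl
  | tail _ h2 ih =>
    obtain ⟨e, he, h'⟩ := h2
    exact .tail ih ⟨e, h he, h'⟩

lemma two_paths (G : Multigraph V E) {P Q : Finset E} {u w : V} (hP : G.IsPath P u w)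
    (hQ : G.IsPath Q u w) (hd : Disjoint P Q) (hi : G.vertsOf P ∩ G.vertsOf Q = {u, w}) :
    G.IsCycle (P ∪ Q) := by
  obtain ⟨huw, hPc, hPu, hPw, hPdu, hPdw, hPd⟩ := hP
  obtain ⟨-, hQc, hQu, hQw, hQdu, hQdw, hQd⟩ := hQ
  have hi' : ∀ x, x ∈ G.vertsOf P → x ∈ G.vertsOf Q → x = u ∨ x = w := by
    intro x h1 h2
    have : x ∈ G.vertsOf P ∩ G.vertsOf Q := Finset.mem_inter.2 ⟨h1, h2⟩
    rw [hi] at this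
    simpa using this
  have hreach : ∀ x ∈ G.vertsOf (P ∪ Q), G.ReachE (P ∪ Q) u x := by
    intro x hx
    rcases (verts_union G).1 hx with h | h
    · exact reach_mono G Finset.subset_union_left (hPc u hPu x h)
    · exact reach_mono G Finset.subset_union_right (hQc u hQu x h)
  refine ⟨?_, ?_, ?_⟩
  · obtain ⟨e, he, _⟩ := (mem_verts G).1 hPu
    exact ⟨e, Finset.mem_union_left _ he⟩
  · intro x hx y hy
    exact Relation.ReflTransGen.trans (reach_symm G (hreach x hx)) (hreach y hy)
  · intro x hx
    rw [deg_union G hd]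
    by_cases hxu : x = u
    · rw [hxu, hPdu, hQdu]
    by_cases hxw : x = w
    · rw [hxw, hPdw, hQdw]
    by_cases h1 : x ∈ G.vertsOf P
    · have h2 : x ∉ G.vertsOf Q := fun h => by
        rcases hi' x h1 h with h | h
        · exact hxu h
        · exact hxw h
      rw [hPd x h1 hxu hxw, deg_zero G h2]
    · rcases (verts_union G).1 hx with h | h
      · exact absurd h h1
      · rw [hQd x h hxu hxw, deg_zero G h1]

/-- A part of an even set supported on one side of a one-vertex attachment is even. -/
lemma ev_part (G : Multigraph V E) {A B : Finset E} {x : V} (hd : Disjoint A B)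
    (hi : ∀ y, y ∈ G.vertsOf A → y ∈ G.vertsOf B → y = x) (hev : Ev G (A ∪ B)) : Ev G A := by
  have h1 : ∀ y, y ≠ x → par G A y = 0 := by
    intro y hy
    by_cases hA : y ∈ G.vertsOf A
    · have hB : y ∉ G.vertsOf B := fun h => hy (hi y hA h)
      have := hev y
      rw [par_union G hd, par_eq G B, deg_zero G hB] at this
      simpa using this
    · rw [par_eq, deg_zero G hA]; rfl
  intro y
  by_cases hy : y = x
  · have := handshake G A Finset.univ (by simp)
    rw [Finset.sum_eq_single x (fun z _ hz => h1 z hz) (by simp)] at this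
    rw [hy]; exact this
  · exact h1 y hy

lemma frame_iff (G : Multigraph V E) (σ : E → ℤˣ) (v : V)
    (hblock : ∀ C : Finset E, G.IsCycle C → v ∉ G.vertsOf C → (∏ e ∈ C, σ e) = 1)
    (C : Finset E) : G.SFrameCircuit σ C ↔ MinBal G (sg σ) C := by
  have hnb : ∀ D, G.IsCycle D → D ∉ G.balancedCycles σ →
      ∑ e ∈ D, sg σ e = 1 ∧ v ∈ G.vertsOf D := by
    intro D hD hn
    have h1 : ∏ e ∈ D, σ e ≠ 1 := fun h => hn ⟨hD, h⟩
    refine ⟨?_, ?_⟩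
    · rw [Ne, bal_iff] at h1
      exact (z2cases _).resolve_left h1
    · by_contra h; exact h1 (hblock D hD h)
  constructor
  · rintro (⟨hc, hb⟩ | ⟨C₁, C₂, ⟨hc1, hc2, hd, hcard⟩, hn1, hn2, rfl⟩ |
      ⟨C₁, C₂, P, ⟨hc1, hc2, hd, _⟩, hn1, hn2, _⟩ |
      ⟨⟨u, w, P₁, P₂, P₃, ⟨hP1, hP2, hP3, d12, d13, d23, i12, i13, i23⟩, rfl⟩, hall⟩)
    · have hm := cycle_minEv G hc
      exact ⟨hm.1, ⟨hm.2.1, (bal_iff σ C).1 hb.2⟩, fun D h1 h2 h3 => hm.2.2 D h1 h2 h3.1⟩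
    · have s1 := (hnb C₁ hc1 hn1).1
      have s2 := (hnb C₂ hc2 hn2).1
      have m1 := cycle_minEv G hc1
      have m2 := cycle_minEv G hc2
      obtain ⟨x, hx⟩ := Finset.card_eq_one.1 hcard
      refine ⟨m1.1.mono Finset.subset_union_left, ⟨fun y => ?_, ?_⟩, ?_⟩
      · rw [par_union G hd, m1.2.1 y, m2.2.1 y, add_zero]
      · rw [Finset.sum_union hd, s1, s2]; rfl
      · rintro D hD hne ⟨hev, hs⟩
        have hDD : (D ∩ C₁) ∪ (D ∩ C₂) = D := by
          rw [← Finset.inter_union_distrib_left]; exact Finset.inter_eq_left.2 hD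
        have hdd : Disjoint (D ∩ C₁) (D ∩ C₂) :=
          Finset.disjoint_of_subset_left Finset.inter_subset_right
            (Finset.disjoint_of_subset_right Finset.inter_subset_right hd)
        have hi : ∀ y, y ∈ G.vertsOf (D ∩ C₁) → y ∈ G.vertsOf (D ∩ C₂) → y = x := by
          intro y h1 h2
          have : y ∈ G.vertsOf C₁ ∩ G.vertsOf C₂ := Finset.mem_inter.2
            ⟨verts_mono G Finset.inter_subset_right h1, verts_mono G Finset.inter_subset_right h2⟩
          rw [hx] at this; simpa using this
        have e1 : Ev G (D ∩ C₁) := ev_part G hdd hi (by rw [hDD]; exact hev)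
        have e2 : Ev G (D ∩ C₂) := ev_part G hdd.symm (fun y h1 h2 => hi y h2 h1)
          (by rw [Finset.union_comm, hDD]; exact hev)
        have c1 : D ∩ C₁ = ∅ ∨ D ∩ C₁ = C₁ := by
          rcases (D ∩ C₁).eq_empty_or_nonempty with h | h
          · exact .inl h
          · exact .inr (m1.2.2 _ Finset.inter_subset_right h e1)
        have c2 : D ∩ C₂ = ∅ ∨ D ∩ C₂ = C₂ := by
          rcases (D ∩ C₂).eq_empty_or_nonempty with h | h
          · exact .inl h
          · exact .inr (m2.2.2 _ Finset.inter_subset_right h e2)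
        rcases c1 with h1 | h1 <;> rcases c2 with h2 | h2 <;> rw [h1, h2] at hDD
        · rw [← hDD] at hne; simp at hne
        · rw [← hDD, Finset.empty_union, s2] at hs; simp at hs
        · rw [← hDD, Finset.union_empty, s1] at hs; simp at hs
        · exact hDD.symm
    · exact absurd (hnb C₂ hc2 hn2).2 (Finset.disjoint_left.1 hd (hnb C₁ hc1 hn1).2)
    · exfalso
      have c12 := two_paths G hP1 hP2 d12 i12
      have c13 := two_paths G hP1 hP3 d13 i13
      have c23 := two_paths G hP2 hP3 d23 i23
      have n12 := (hnb _ c12 (hall _ Finset.subset_union_left c12)).1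
      have n13 := (hnb _ c13 (hall _ (by
        intro y; simp only [Finset.mem_union]; tauto) c13)).1
      have n23 := (hnb _ c23 (hall _ (by
        intro y; simp only [Finset.mem_union]; tauto) c23)).1
      rw [Finset.sum_union d12] at n12
      rw [Finset.sum_union d13] at n13
      rw [Finset.sum_union d23] at n23
      generalize ∑ e ∈ P₁, sg σ e = x at *
      generalize ∑ e ∈ P₂, sg σ e = y at *
      generalize ∑ e ∈ P₃, sg σ e = z at *
      revert x y z
      decide
  · rintro ⟨hne, ⟨hev, hs⟩, hmin⟩
    by_cases hC : G.IsCycle C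
    · exact .inl ⟨hC, hC, (bal_iff σ C).2 hs⟩
    refine .inr (.inl ?_)
    obtain ⟨C₁, h1, hc1⟩ := exists_cycle G C hne hev
    have m1 := cycle_minEv G hc1
    have unb : ∀ D ⊆ C, G.IsCycle D → D ∉ G.balancedCycles σ := by
      rintro D hD hc ⟨_, hb⟩
      have := hmin D hD hc.1 ⟨cycle_even G hc, (bal_iff σ D).1 hb⟩
      exact hC (this ▸ hc)
    have hne2 : (C \ C₁).Nonempty := by
      rw [Finset.sdiff_nonempty]
      intro h
      exact hC (Finset.Subset.antisymm h h1 ▸ hc1)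
    obtain ⟨C₂, h2, hc2⟩ := exists_cycle G (C \ C₁) hne2 (ev_sdiff G h1 hev m1.2.1)
    have m2 := cycle_minEv G hc2
    have h2C : C₂ ⊆ C := h2.trans Finset.sdiff_subset
    have hd : Disjoint C₁ C₂ := by
      rw [Finset.disjoint_left]
      intro y hy hy2
      exact (Finset.mem_sdiff.1 (h2 hy2)).2 hy
    obtain ⟨s1, v1⟩ := hnb C₁ hc1 (unb _ h1 hc1)
    obtain ⟨s2, v2⟩ := hnb C₂ hc2 (unb _ h2C hc2)
    have hU : C₁ ∪ C₂ = C := by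
      apply hmin _ (Finset.union_subset h1 h2C) (m1.1.mono Finset.subset_union_left)
      refine ⟨fun y => ?_, ?_⟩
      · rw [par_union G hd, m1.2.1 y, m2.2.1 y, add_zero]
      · rw [Finset.sum_union hd, s1, s2]; rfl
    refine ⟨C₁, C₂, ⟨hc1, hc2, hd, ?_⟩, unb _ h1 hc1, unb _ h2C hc2, hU.symm⟩
    rw [Finset.card_eq_one]
    refine ⟨v, ?_⟩
    apply Finset.Subset.antisymm
    swap
    · simp [v1, v2]
    intro w hw
    rw [Finset.mem_singleton]
    by_contra hwv
    obtain ⟨w1, w2⟩ := Finset.mem_inter.1 hw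
    obtain ⟨J1, j1, p1⟩ := tjoin G (hc1.2.1 v v1 w w1)
    obtain ⟨J2, j2, p2⟩ := tjoin G (hc2.2.1 v v2 w w2)
    have hJ1ne : J1.Nonempty := by
      rw [Finset.nonempty_iff_ne_empty]
      rintro rfl
      have := p1 v
      simp [par, hwv] at this
    have hJ1C : J1 ≠ C₁ := by
      rintro rfl
      have := p1 v
      rw [m1.2.1 v] at this
      simp [hwv] at this
    have step : ∀ K ⊆ C₂, (∀ y, par G K y = par G J1 y) →
        ∑ e ∈ J1, sg σ e + ∑ e ∈ K, sg σ e ≠ 0 := by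
      intro K hK hp hz
      have hdK : Disjoint J1 K :=
        Finset.disjoint_of_subset_left j1 (Finset.disjoint_of_subset_right hK hd)
      have := hmin (J1 ∪ K) (Finset.union_subset (j1.trans h1) (hK.trans h2C))
        (hJ1ne.mono Finset.subset_union_left)
        ⟨fun y => by rw [par_union G hdK, hp, z2], by rw [Finset.sum_union hdK]; exact hz⟩
      apply hJ1C
      apply Finset.Subset.antisymm j1
      intro e he
      have h3 : e ∈ J1 ∪ K := this ▸ h1 he
      rcases Finset.mem_union.1 h3 with h | h
      · exact h
      · exact absurd (hK h) (Finset.disjoint_left.1 hd he)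
    have r1 := step J2 j2 (fun y => by rw [p1, p2])
    have r2 := step (C₂ \ J2) Finset.sdiff_subset (fun y => by
      have h3 := sum_sdiff' (fun e => (inc G e y : ZMod 2)) j2
      have h4 := m2.2.1 y
      have h5 := p2 y
      have h6 := p1 y
      unfold par at *
      rw [h3, h4, h5, h6, zero_add])
    rw [sum_sdiff' _ j2, s2] at r2
    generalize ∑ e ∈ J1, sg σ e = x at *
    generalize ∑ e ∈ J2, sg σ e = y at *
    clear * - r1 r2
    revert x y
    decide

end BVS

/-- An unbalanced signed graph with a blocking vertex `v` has
`F(Ω) = M(H)` for a graph `H` from which the underlying graph `Γ` is obtained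
by identifying two vertices into `v`. -/
theorem blocking_vertex_split (Γ : Multigraph V E) (σ : E → ℤˣ)
    (hunb : ∃ C : Finset E, Γ.IsCycle C ∧ (∏ e ∈ C, σ e) ≠ 1)
    (v : V)
    (hblock : ∀ C : Finset E, Γ.IsCycle C → v ∉ Γ.vertsOf C → (∏ e ∈ C, σ e) = 1) :
    ∃ H : Multigraph (V ⊕ Unit) E,
      (∀ e, Γ.ends e = Sym2.map (Sum.elim id fun _ => v) (H.ends e)) ∧
      (∀ C : Finset E, Γ.SFrameCircuit σ C ↔ H.IsCycle C) := by
  have hb : ∀ D, BVS.Ev Γ D → (∀ e ∈ D, v ∉ Γ.ends e) → ∑ e ∈ D, BVS.sg σ e = 0 :=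
    fun D h1 h2 => BVS.even_avoid Γ (BVS.sg σ) v
      (fun C hC hv => (BVS.bal_iff σ C).1 (hblock C hC hv)) D h1 h2
  obtain ⟨H, hH, hE⟩ := BVS.exists_split Γ (BVS.sg σ) v hb
  refine ⟨H, hH, fun C => ?_⟩
  rw [BVS.frame_iff Γ σ v hblock, BVS.cycle_iff]
  unfold BVS.MinBal BVS.MinEv
  simp only [hE]
end
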